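/- Let R be a commutative Noetherian ring of finite Krull dimension, let a be an ideal of R, and let M be a finitely generated R-module of finite projective dimension with Supp_R M = Spec R. Then cd(a,R) ≤ sup over i ∈ ℕ of (cd(a, Ext^i_R(M,R)) + i); that is, whenever H^j_a(R) ≠ 0 there exist i, j' ≥ 0 with H^{j'}_a(Ext^i_R(M,R)) ≠ 0 and j ≤ j' + i. (Second part of Corollary 3.4.) -/

import Mathlib

/-!
Common definitions: Ext modules, dimension of a module (Krull dimension of its
support, in `WithBot ℕ∞`, with `⊥` for the zero module), projective/injective
dimension via the Ext-vanishing characterization, and cohomological dimension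
with respect to an ideal via local cohomology.
-/

open CategoryTheory TensorProduct

universe u

/-- The `i`-th Ext module `Ext^i_R(M, N)` of two `R`-modules. -/
noncomputable def extMod (R : Type u) [CommRing R] (i : ℕ) (M N : ModuleCat.{u} R) :
    ModuleCat.{u} R :=
  ((Ext R (ModuleCat.{u} R) i).obj (Opposite.op M)).obj N

/-- The dimension `dim_R M` of an `R`-module: the Krull dimension of its support
`Supp_R M ⊆ Spec R`, an element of `WithBot ℕ∞` which is `⊥ = -∞` for the zero module. -/
noncomputable def supportDim (R : Type u) [CommRing R] (M : Type u) [AddCommGroup M]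
    [Module R M] : WithBot ℕ∞ :=
  Order.krullDim (Module.support R M)

/-- `M` has projective dimension at most `n`: `Ext^{n+1}_R(M, N) = 0` for every `N`. -/
def projDimLE (R : Type u) [CommRing R] (M : ModuleCat.{u} R) (n : ℕ) : Prop :=
  ∀ N : ModuleCat.{u} R, Subsingleton (extMod R (n + 1) M N)

/-- The projective dimension `proj.dim_R M`, as an element of `WithBot ℕ∞`
(it is `⊤` when `M` does not have finite projective dimension). -/
noncomputable def projDim (R : Type u) [CommRing R] (M : ModuleCat.{u} R) : WithBot ℕ∞ :=
  sInf {d : WithBot ℕ∞ | ∃ n : ℕ, d = n ∧ projDimLE R M n}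

/-- `N` has injective dimension at most `n`: `Ext^{n+1}_R(M, N) = 0` for every `M`. -/
def injDimLE (R : Type u) [CommRing R] (N : ModuleCat.{u} R) (n : ℕ) : Prop :=
  ∀ M : ModuleCat.{u} R, Subsingleton (extMod R (n + 1) M N)

/-- The cohomological dimension `cd(a, M)`: the supremum of those `i` with
`H^i_a(M) ≠ 0`, an element of `WithBot ℕ∞` which is `⊥ = -∞` when all the local
cohomology modules vanish. -/
noncomputable def cohDim (R : Type u) [CommRing R] (a : Ideal R) (M : ModuleCat.{u} R) :
    WithBot ℕ∞ :=
  ⨆ i ∈ {i : ℕ | ¬ Subsingleton ((localCohomology a i).obj M)}, (i : WithBot ℕ∞)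

section LocalCohomology

open Limits Opposite

universe w v

namespace CategoryTheory.ProjectiveResolution

section
variable {C : Type u} [Category.{v} C] [Abelian C] [HasExt.{w} C] {X Y : C}

open CochainComplex.HomComplex in
lemma extMk_zero_eq_zero_iff (P : ProjectiveResolution X) (f : P.complex.X 0 ⟶ Y)
    (hf : P.complex.d 1 0 ≫ f = 0) : P.extMk f 1 rfl hf = 0 ↔ f = 0 := by
  simp only [← P.extEquivCohomologyClass.apply_eq_iff_eq,
    extEquivCohomologyClass_extMk, extEquivCohomologyClass_zero,
    CohomologyClass.mk_eq_zero_iff]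
  rw [Cocycle.toSingleMk_mem_coboundaries_iff _ _ _ _ _ 1 (by lia)]
  have h : IsZero (P.cochainComplex.X 1) := P.cochainComplex.isZero_of_isStrictlyLE 0 1
  constructor
  · rintro ⟨g, hg⟩
    rw [h.eq_of_src g 0, comp_zero] at hg
    rw [← cancel_epi (P.cochainComplexXIso (-0) 0 rfl).hom, comp_zero]
    exact hg.symm
  · rintro rfl
    exact ⟨0, by simp⟩

lemma extMk_eq_zero_iff_pred (P : ProjectiveResolution X) {n : ℕ} (f : P.complex.X n ⟶ Y)
    (hf : P.complex.d (n + 1) n ≫ f = 0) :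
    P.extMk f (n + 1) rfl hf = 0 ↔ ∃ g : P.complex.X (n - 1) ⟶ Y, P.complex.d n (n - 1) ≫ g = f := by
  cases n with
  | zero =>
    rw [extMk_zero_eq_zero_iff]
    constructor
    · rintro rfl
      exact ⟨0, by simp⟩
    · rintro ⟨g, rfl⟩
      simp
  | succ n => exact P.extMk_eq_zero_iff _ _ _ _ _ rfl
end

section
variable {R : Type*} [Ring R] {C : Type u} [Category.{v} C] [Abelian C] [Linear R C]
  [EnoughProjectives C] [HasExt.{w} C] {X X' Y : C}

omit [EnoughProjectives C] [HasExt.{w} C] in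
lemma linearYonedaObj_d_iCycles (P : ProjectiveResolution X) (n : ℕ)
    (z : (P.complex.linearYonedaObj R Y).cycles n) :
    P.complex.d (n + 1) n ≫ ((P.complex.linearYonedaObj R Y).iCycles n z : P.complex.X n ⟶ Y) = 0 := by
  have := (P.complex.linearYonedaObj R Y).iCycles_d n (n + 1)
  exact ConcreteCategory.congr_hom this z

/-- A class in the functorial `Ext` and a cocycle on the projective resolution `P` represent
the same class. -/
def extRel (P : ProjectiveResolution X) (n : ℕ) (x : ((Ext R C n).obj (op X)).obj Y)
    (e : Abelian.Ext.{w} X Y n) : Prop :=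
  ∃ z : (P.complex.linearYonedaObj R Y).cycles n,
    x = (P.isoExt n Y).inv ((P.complex.linearYonedaObj R Y).homologyπ n z) ∧
    e = P.extMk ((P.complex.linearYonedaObj R Y).iCycles n z) (n + 1) rfl
      (P.linearYonedaObj_d_iCycles n z)

lemma exists_extRel_left (P : ProjectiveResolution X) (n : ℕ)
    (x : ((Ext R C n).obj (op X)).obj Y) : ∃ e : Abelian.Ext.{w} X Y n, P.extRel n x e := by
  obtain ⟨z, hz⟩ := (ModuleCat.epi_iff_surjective
    ((P.complex.linearYonedaObj R Y).homologyπ n)).1 inferInstance ((P.isoExt n Y).hom x)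
  exact ⟨_, z, by rw [hz]; simp, rfl⟩

lemma exists_extRel_right (P : ProjectiveResolution X) (n : ℕ)
    (e : Abelian.Ext.{w} X Y n) : ∃ x : ((Ext R C n).obj (op X)).obj Y, P.extRel n x e := by
  obtain ⟨f, hf, rfl⟩ := P.extMk_surjective e (n + 1) rfl
  obtain ⟨z, hz⟩ := (ShortComplex.moduleCat_exact_iff _).1
    (ShortComplex.exact_of_f_is_kernel (.mk _ _
      ((P.complex.linearYonedaObj R Y).iCycles_d n (n + 1)))
      ((P.complex.linearYonedaObj R Y).cyclesIsKernel n (n + 1) (by simp))) f hf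
  refine ⟨_, z, rfl, ?_⟩
  congr 1
  exact hz.symm

lemma extRel.eq_zero_iff {P : ProjectiveResolution X} {n : ℕ}
    {x : ((Ext R C n).obj (op X)).obj Y} {e : Abelian.Ext.{w} X Y n} (h : P.extRel n x e) :
    x = 0 ↔ e = 0 := by
  obtain ⟨z, rfl, rfl⟩ := h
  refine Iff.trans ?_ (extMk_eq_zero_iff_pred P _ (P.linearYonedaObj_d_iCycles n z)).symm
  have h1 : ∀ y, (P.isoExt (R := R) n Y).inv y = 0 ↔ y = 0 := fun y ↦ by
    refine map_eq_zero_iff _ ((ModuleCat.mono_iff_injective _).1 inferInstance)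
  have hp : (ComplexShape.up ℕ).prev n = n - 1 := by cases n <;> simp
  rw [h1]
  have h2 := (ShortComplex.moduleCat_exact_iff _).1
    (ShortComplex.exact_of_g_is_cokernel (.mk _ _
      ((P.complex.linearYonedaObj R Y).toCycles_comp_homologyπ (n - 1) n))
      ((P.complex.linearYonedaObj R Y).homologyIsCokernel (n - 1) n hp)) z
  constructor
  · intro hz
    obtain ⟨g, hg⟩ := h2 hz
    refine ⟨g, ?_⟩
    have := ConcreteCategory.congr_hom ((P.complex.linearYonedaObj R Y).toCycles_i (n - 1) n) g
    rw [← hg]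
    exact this.symm
  · rintro ⟨g, hg⟩
    have h3 : z = (P.complex.linearYonedaObj R Y).toCycles (n - 1) n g := by
      apply (ModuleCat.mono_iff_injective ((P.complex.linearYonedaObj R Y).iCycles n)).1
        inferInstance
      have := ConcreteCategory.congr_hom ((P.complex.linearYonedaObj R Y).toCycles_i (n - 1) n) g
      exact hg.symm.trans this.symm
    rw [h3]
    exact ConcreteCategory.congr_hom
      ((P.complex.linearYonedaObj R Y).toCycles_comp_homologyπ (n - 1) n) g

/-- The map of `Hom` complexes induced by a chain map between projective resolutions. -/
def linearYonedaMap {P : ProjectiveResolution X} {P' : ProjectiveResolution X'}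
    (φ : P'.complex ⟶ P.complex) (Y : C) :
    P.complex.linearYonedaObj R Y ⟶ P'.complex.linearYonedaObj R Y :=
  ((HomologicalComplex.unopFunctor _ _).map
    ((((linearYoneda R C).obj Y).rightOp.mapHomologicalComplex _).map φ).op)

omit [HasExt.{w} C] in
lemma isoExt_inv_naturality {P : ProjectiveResolution X} {P' : ProjectiveResolution X'}
    {g : X' ⟶ X} (φ : Hom P' P g) (n : ℕ) :
    (P.isoExt n Y).inv ≫ ((Ext R C n).map g.op).app Y =
      HomologicalComplex.homologyMap (linearYonedaMap φ.hom Y) n ≫ (P'.isoExt n Y).inv := by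
  have h1 := congrArg Quiver.Hom.unop (isoLeftDerivedObj_hom_naturality g P' P φ.hom
    (by simpa using φ.hom_f_zero_comp_π_f_zero) ((linearYoneda R C).obj Y).rightOp n)
  have h2 := congrArg Quiver.Hom.unop
    (HomologicalComplex.homologyOp_hom_naturality (linearYonedaMap (R := R) φ.hom Y) n)
  let A := (HomologicalComplex.homologyUnop
    ((((linearYoneda R C).obj Y).rightOp.mapHomologicalComplex _).obj P.complex) n).hom
  let B := (P'.isoLeftDerivedObj ((linearYoneda R C).obj Y).rightOp n).hom.unop
  have h1' := congrArg (fun t ↦ A ≫ t) h1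
  have h2' := congrArg (fun t ↦ t ≫ B) h2
  refine (Category.assoc _ _ _).trans (h1'.trans ?_)
  refine Eq.trans ?_ (h2'.trans ?_)
  · exact (Category.assoc _ _ _).symm
  · exact Category.assoc _ _ _

lemma extRel.naturality {P : ProjectiveResolution X} {P' : ProjectiveResolution X'}
    {g : X' ⟶ X} (φ : Hom P' P g) {n : ℕ}
    {x : ((Ext R C n).obj (op X)).obj Y} {e : Abelian.Ext.{w} X Y n} (h : P.extRel n x e) :
    P'.extRel n (((Ext R C n).map g.op).app Y x) ((Abelian.Ext.mk₀ g).comp e (zero_add n)) := by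
  obtain ⟨z, rfl, rfl⟩ := h
  refine ⟨HomologicalComplex.cyclesMap (linearYonedaMap φ.hom Y) n z, ?_, ?_⟩
  · have h1 := ConcreteCategory.congr_hom (isoExt_inv_naturality (R := R) (Y := Y) φ n)
      ((P.complex.linearYonedaObj R Y).homologyπ n z)
    have h2 := ConcreteCategory.congr_hom
      (HomologicalComplex.homologyπ_naturality (linearYonedaMap (R := R) φ.hom Y) n) z
    exact h1.trans (congrArg (P'.isoExt n Y).inv h2)
  · refine (mk₀_comp_extMk _ _ _ (P.linearYonedaObj_d_iCycles n z) φ).trans ?_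
    congr 1
    exact (ConcreteCategory.congr_hom
      (HomologicalComplex.cyclesMap_i (linearYonedaMap (R := R) φ.hom Y) n) z).symm

end
end CategoryTheory.ProjectiveResolution

open ProjectiveResolution in
lemma Ext_forall_exists_map_eq_zero_iff {R : Type*} [Ring R] {C : Type u} [Category.{v} C]
    [Abelian C] [Linear R C] [EnoughProjectives C] [HasExt.{w} C] {ι : Type*} {X Y : C} (n : ℕ)
    {X' : ι → C} (g : ∀ i, X' i ⟶ X) :
    (∀ x : ((Ext R C n).obj (op X)).obj Y, ∃ i, ((Ext R C n).map (g i).op).app Y x = 0) ↔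
      ∀ e : Abelian.Ext.{w} X Y n, ∃ i, (Abelian.Ext.mk₀ (g i)).comp e (zero_add n) = 0 := by
  let φ (i : ι) : (projectiveResolution (X' i)).Hom (projectiveResolution X) (g i) :=
    { hom := lift (g i) _ _
      hom_f_zero_comp_π_f_zero := by simpa using lift_commutes_zero (g i) _ _ }
  constructor
  · intro h e
    obtain ⟨x, hx⟩ := exists_extRel_right (R := R) (projectiveResolution X) n e
    obtain ⟨i, hi⟩ := h x
    exact ⟨i, (hx.naturality (φ i)).eq_zero_iff.1 hi⟩
  · intro h x
    obtain ⟨e, hx⟩ := exists_extRel_left (R := R) (projectiveResolution X) n x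
    obtain ⟨i, hi⟩ := h e
    exact ⟨i, (hx.naturality (φ i)).eq_zero_iff.2 hi⟩

/-- The projection `R ⧸ a ^ s ⟶ R ⧸ a ^ t` for `t ≤ s`. -/
def quotientPowMap {R : Type u} [CommRing R] (a : Ideal R) {t s : ℕ} (h : t ≤ s) :
    ModuleCat.of R (R ⧸ a ^ s) ⟶ ModuleCat.of R (R ⧸ a ^ t) :=
  ModuleCat.ofHom (Submodule.mapQ _ _ LinearMap.id (Ideal.pow_le_pow_right h))

/-- Every class in `Ext^n(R ⧸ a ^ t, Y)` dies in some `Ext^n(R ⧸ a ^ s, Y)`. -/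
def LocalCohomologyVanishes {R : Type u} [CommRing R] (a : Ideal R) (n : ℕ) (Y : ModuleCat.{u} R) :
    Prop :=
  ∀ (t : ℕ) (e : Abelian.Ext.{u} (ModuleCat.of R (R ⧸ a ^ t)) Y n), ∃ (s : ℕ) (h : t ≤ s),
    (Abelian.Ext.mk₀ (quotientPowMap a h)).comp e (zero_add n) = 0

lemma ModuleCat.subsingleton_pt_iff_of_isFiltered {R : Type u} [Ring R] {J : Type}
    [SmallCategory J] [IsFiltered J] {F : J ⥤ ModuleCat.{u} R} {c : Cocone F} (hc : IsColimit c) :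
    Subsingleton c.pt ↔ ∀ (j : J) (x : F.obj j), ∃ (k : J) (f : j ⟶ k), F.map f x = 0 := by
  have : PreservesFilteredColimitsOfSize.{0, 0} (forget (ModuleCat.{u} R)) :=
    preservesFilteredColimitsOfSize_shrink.{0, u, 0, u} _
  constructor
  · intro h j x
    obtain ⟨k, f, hf⟩ := (hc.eq_iff' x 0).1 (h.elim _ _)
    exact ⟨k, f, hf.trans (map_zero _)⟩
  · intro h
    suffices H : ∀ y : c.pt, y = 0 from ⟨fun y z ↦ (H y).trans (H z).symm⟩
    intro y
    obtain ⟨j, x, rfl⟩ := Concrete.isColimit_exists_rep _ hc y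
    obtain ⟨k, f, hf⟩ := h j x
    rw [← c.w f, ConcreteCategory.comp_apply, hf, map_zero]

lemma subsingleton_localCohomology_iff {R : Type u} [CommRing R] (a : Ideal R) (n : ℕ)
    (Y : ModuleCat.{u} R) :
    Subsingleton ((localCohomology a n).obj Y) ↔ LocalCohomologyVanishes a n Y := by
  have key (t : ℕ) := Ext_forall_exists_map_eq_zero_iff (R := R) (Y := Y) n
    (fun i : {s // t ≤ s} ↦ quotientPowMap a i.2)
  simp only [Subtype.exists] at key
  simp only [LocalCohomologyVanishes, ← key]
  have := localCohomology.hasColimitDiagram.{u, 0} (localCohomology.idealPowersDiagram a) n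
  let F := localCohomology.diagram (localCohomology.idealPowersDiagram a) n
  have hc := isColimitOfPreserves ((evaluation (ModuleCat.{u} R) (ModuleCat.{u} R)).obj Y)
    (colimit.isColimit F)
  refine (ModuleCat.subsingleton_pt_iff_of_isFiltered hc).trans ⟨?_, ?_⟩
  · intro h t x
    obtain ⟨k, f, hf⟩ := h (op (op t)) x
    exact ⟨k.unop.unop, leOfHom f.unop.unop, hf⟩
  · intro h j x
    obtain ⟨s, hs, h0⟩ := h j.unop.unop x
    exact ⟨op (op s), (homOfLE hs).op.op, h0⟩

lemma ModuleCat.shortExact_of_linearMap {R : Type u} [Ring R] {A B C : Type v}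
    [AddCommGroup A] [Module R A] [AddCommGroup B] [Module R B] [AddCommGroup C] [Module R C]
    (f : A →ₗ[R] B) (g : B →ₗ[R] C) (hf : Function.Injective f) (hg : Function.Surjective g)
    (hfg : Function.Exact f g) :
    (ShortComplex.mk (ModuleCat.ofHom f) (ModuleCat.ofHom g) (by
      ext x; exact hfg.apply_apply_eq_zero x)).ShortExact := by
  have : Mono (ModuleCat.ofHom f) := (ModuleCat.mono_iff_injective _).2 hf
  have : Epi (ModuleCat.ofHom g) := (ModuleCat.epi_iff_surjective _).2 hg
  exact ⟨(ShortComplex.ShortExact.moduleCat_exact_iff_function_exact _).2 hfg⟩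

namespace LocalCohomologyVanishes

variable {R : Type u} [CommRing R] {a : Ideal R} {n : ℕ}

lemma quotientPowMap_comp (a : Ideal R) {t s r : ℕ} (h : t ≤ s) (h' : s ≤ r) :
    quotientPowMap a h' ≫ quotientPowMap a h = quotientPowMap a (h.trans h') := by
  refine ModuleCat.hom_ext (LinearMap.ext fun x ↦ ?_)
  obtain ⟨x, rfl⟩ := Submodule.Quotient.mk_surjective _ x
  rfl

lemma of_shortExact₂ {S : ShortComplex (ModuleCat.{u} R)} (hS : S.ShortExact)
    (h₁ : LocalCohomologyVanishes a n S.X₁) (h₃ : LocalCohomologyVanishes a n S.X₃) :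
    LocalCohomologyVanishes a n S.X₂ := by
  intro t e
  obtain ⟨s, hs, h⟩ := h₃ t (e.comp (Abelian.Ext.mk₀ S.g) (add_zero n))
  rw [← Abelian.Ext.comp_assoc_of_third_deg_zero] at h
  obtain ⟨e', he'⟩ := Abelian.Ext.covariant_sequence_exact₂ _ hS _ h
  obtain ⟨r, hr, h'⟩ := h₁ s e'
  refine ⟨r, hs.trans hr, ?_⟩
  rw [← quotientPowMap_comp a hs hr, ← Abelian.Ext.mk₀_comp_mk₀_assoc, ← he',
    ← Abelian.Ext.comp_assoc_of_third_deg_zero, h', Abelian.Ext.zero_comp]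

lemma of_shortExact₃ {S : ShortComplex (ModuleCat.{u} R)} (hS : S.ShortExact)
    (h₁ : LocalCohomologyVanishes a (n + 1) S.X₁) (h₂ : LocalCohomologyVanishes a n S.X₂) :
    LocalCohomologyVanishes a n S.X₃ := by
  intro t e
  obtain ⟨s, hs, h⟩ := h₁ t (e.comp hS.extClass rfl)
  rw [← Abelian.Ext.comp_assoc _ _ _ (zero_add n) rfl (by lia)] at h
  obtain ⟨e', he'⟩ := Abelian.Ext.covariant_sequence_exact₃ _ hS _ rfl h
  obtain ⟨r, hr, h'⟩ := h₂ s e'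
  refine ⟨r, hs.trans hr, ?_⟩
  rw [← quotientPowMap_comp a hs hr, ← Abelian.Ext.mk₀_comp_mk₀_assoc, ← he',
    ← Abelian.Ext.comp_assoc_of_third_deg_zero, h', Abelian.Ext.zero_comp]

lemma of_iso {X Y : ModuleCat.{u} R} (i : X ≅ Y) (h : LocalCohomologyVanishes a n X) :
    LocalCohomologyVanishes a n Y := by
  intro t e
  obtain ⟨s, hs, h⟩ := h t (e.comp (Abelian.Ext.mk₀ i.inv) (add_zero n))
  refine ⟨s, hs, ?_⟩
  have := congrArg (fun z ↦ z.comp (Abelian.Ext.mk₀ i.hom) (add_zero n)) h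
  simpa using this

lemma of_subsingleton (X : ModuleCat.{u} R) [Subsingleton X] : LocalCohomologyVanishes a n X := by
  intro t e
  refine ⟨t, le_rfl, ?_⟩
  have : (𝟙 X) = 0 := (ModuleCat.isZero_of_subsingleton X).eq_of_src _ _
  rw [← Abelian.Ext.comp_mk₀_id e, this]
  simp

section

variable {A B C : Type u} [AddCommGroup A] [Module R A] [AddCommGroup B] [Module R B]
  [AddCommGroup C] [Module R C]

lemma of_linearEquiv (e : A ≃ₗ[R] B) (h : LocalCohomologyVanishes a n (ModuleCat.of R A)) :
    LocalCohomologyVanishes a n (ModuleCat.of R B) :=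
  h.of_iso e.toModuleIso

lemma of_exact₂ {f : A →ₗ[R] B} {g : B →ₗ[R] C} (hf : Function.Injective f)
    (hg : Function.Surjective g) (hfg : Function.Exact f g)
    (h₁ : LocalCohomologyVanishes a n (ModuleCat.of R A))
    (h₃ : LocalCohomologyVanishes a n (ModuleCat.of R C)) :
    LocalCohomologyVanishes a n (ModuleCat.of R B) :=
  of_shortExact₂ (ModuleCat.shortExact_of_linearMap f g hf hg hfg) h₁ h₃

lemma of_exact₃ {f : A →ₗ[R] B} {g : B →ₗ[R] C} (hf : Function.Injective f)
    (hg : Function.Surjective g) (hfg : Function.Exact f g)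
    (h₁ : LocalCohomologyVanishes a (n + 1) (ModuleCat.of R A))
    (h₂ : LocalCohomologyVanishes a n (ModuleCat.of R B)) :
    LocalCohomologyVanishes a n (ModuleCat.of R C) :=
  of_shortExact₃ (ModuleCat.shortExact_of_linearMap f g hf hg hfg) h₁ h₂

lemma of_isSMulRegular {x : R} (hx : x ∈ a) (hreg : IsSMulRegular A x) {g : A →ₗ[R] C}
    (hg : Function.Surjective g) (hfg : Function.Exact (LinearMap.lsmul R A x) g)
    (h : LocalCohomologyVanishes a n (ModuleCat.of R C)) :
    LocalCohomologyVanishes a (n + 1) (ModuleCat.of R A) := by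
  have hS := ModuleCat.shortExact_of_linearMap (LinearMap.lsmul R A x) g hreg hg hfg
  have smul_eq {X : ModuleCat.{u} R} (e : Abelian.Ext.{u} X (ModuleCat.of R A) (n + 1)) :
      e.comp (Abelian.Ext.mk₀ (ModuleCat.ofHom (LinearMap.lsmul R A x))) (add_zero _) = x • e := by
    rw [Abelian.Ext.smul_eq_comp_mk₀]
    rfl
  have key (k t : ℕ) (e : Abelian.Ext.{u} (ModuleCat.of R (R ⧸ a ^ t)) (ModuleCat.of R A) (n + 1))
      (he : x ^ k • e = 0) : ∃ (s : ℕ) (h : t ≤ s),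
        (Abelian.Ext.mk₀ (quotientPowMap a h)).comp e (zero_add _) = 0 := by
    induction k generalizing t with
    | zero => exact ⟨t, le_rfl, by rw [pow_zero, one_smul] at he; rw [he, Abelian.Ext.comp_zero]⟩
    | succ k ih =>
      rw [pow_succ', mul_smul, ← smul_eq] at he
      obtain ⟨e', he'⟩ := Abelian.Ext.covariant_sequence_exact₁ _ hS _ he rfl
      obtain ⟨s, hs, h'⟩ := h t e'
      obtain ⟨r, hr, h''⟩ := ih s ((Abelian.Ext.mk₀ (quotientPowMap a hs)).comp e (zero_add _)) (by
        rw [← Abelian.Ext.comp_smul, ← he',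
          ← Abelian.Ext.comp_assoc _ _ _ (zero_add n) rfl (by lia), h',
          Abelian.Ext.zero_comp])
      exact ⟨r, hs.trans hr, by
        rwa [← quotientPowMap_comp a hs hr, ← Abelian.Ext.mk₀_comp_mk₀_assoc]⟩
  intro t e
  refine key t t e ?_
  rw [← Abelian.Ext.mk₀_id_comp e, ← Abelian.Ext.smul_comp, ← Abelian.Ext.mk₀_smul]
  have : x ^ t • 𝟙 (ModuleCat.of R (R ⧸ a ^ t)) = 0 := by
    refine ModuleCat.hom_ext (LinearMap.ext fun y ↦ ?_)
    obtain ⟨y, rfl⟩ := Submodule.Quotient.mk_surjective _ y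
    exact (Submodule.Quotient.mk_eq_zero _).2 (Ideal.mul_mem_right _ _ (Ideal.pow_mem_pow hx t))
  rw [this, Abelian.Ext.mk₀_zero, Abelian.Ext.zero_comp]

end

end LocalCohomologyVanishes

section

variable {R : Type u} [CommRing R] {a : Ideal R}

lemma LinearMap.exact_subtype_ker {A B : Type*} [AddCommGroup A] [Module R A] [AddCommGroup B]
    [Module R B] (f : A →ₗ[R] B) : Function.Exact f.ker.subtype f := by
  rw [LinearMap.exact_iff, Submodule.range_subtype]

lemma Abelian.Ext.exists_forall_comp_eq_zero_of_shortExact {L : ModuleCat.{u} R} {n : ℕ}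
    {S : ShortComplex (ModuleCat.{u} R)} (hS : S.ShortExact) [Projective S.X₂]
    (h : ∀ e : Abelian.Ext.{u} S.X₁ L n, ∃ s : ℕ,
      (Abelian.Ext.mk₀ (ModuleCat.ofHom (a ^ s • ⊤ : Submodule R S.X₁).subtype)).comp e
        (zero_add n) = 0)
    (e : Abelian.Ext.{u} S.X₃ L (n + 1)) : ∃ s : ℕ,
      ∀ (T : ShortComplex (ModuleCat.{u} R)) (_ : T.ShortExact) (φ : T ⟶ S),
        (∀ x, φ.τ₁ x ∈ (a ^ s • ⊤ : Submodule R S.X₁)) →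
          (Abelian.Ext.mk₀ φ.τ₃).comp e (zero_add _) = 0 := by
  obtain ⟨e', rfl⟩ := Abelian.Ext.contravariant_sequence_exact₃ hS L e
    (Abelian.Ext.eq_zero_of_projective _) (add_comm 1 n)
  obtain ⟨s, hs⟩ := h e'
  refine ⟨s, fun T hT φ hφ ↦ ?_⟩
  have hfac : φ.τ₁ = ModuleCat.ofHom (φ.τ₁.hom.codRestrict _ hφ) ≫
      ModuleCat.ofHom (a ^ s • ⊤ : Submodule R S.X₁).subtype := rfl
  rw [← Abelian.Ext.comp_assoc _ _ _ (zero_add 1) (add_comm 1 n) (by lia),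
    ← ShortComplex.ShortExact.extClass_naturality hT hS φ,
    Abelian.Ext.comp_assoc_of_second_deg_zero, hfac, ← Abelian.Ext.mk₀_comp_mk₀_assoc, hs]
  simp

lemma Submodule.mem_smul_top_of_coe_mem {M : Type*} [AddCommGroup M] [Module R M]
    {N : Submodule R M} {I : Ideal R} {x : N} (h : (x : M) ∈ I • N) :
    x ∈ (I • ⊤ : Submodule R N) := by
  have : I • N = (I • ⊤ : Submodule R N).map N.subtype := by
    rw [Submodule.map_smul'', Submodule.map_top, Submodule.range_subtype]
  rw [this] at h
  obtain ⟨y, hy, hyx⟩ := h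
  rwa [← Subtype.ext (a1 := y) (a2 := x) hyx]

lemma Abelian.Ext.exists_restrict_eq_zero_of_smul_eq_zero [IsNoetherianRing R] {L : ModuleCat.{u} R}
    (hL : ∀ x ∈ a, ∀ y : L, x • y = 0) (n : ℕ) (K : ModuleCat.{u} R) [Module.Finite R K]
    (e : Abelian.Ext.{u} K L n) : ∃ s : ℕ,
      (Abelian.Ext.mk₀ (ModuleCat.ofHom (a ^ s • ⊤ : Submodule R K).subtype)).comp e
        (zero_add n) = 0 := by
  induction n generalizing K with
  | zero =>
    obtain ⟨φ, rfl⟩ := (Abelian.Ext.mk₀_bijective _ _).2 e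
    refine ⟨1, ?_⟩
    rw [Abelian.Ext.mk₀_comp_mk₀]
    suffices h : ModuleCat.ofHom (a ^ 1 • ⊤ : Submodule R K).subtype ≫ φ = 0 by
      rw [h, Abelian.Ext.mk₀_zero]
    refine ModuleCat.hom_ext (LinearMap.ext fun ⟨y, hy⟩ ↦ ?_)
    change φ.hom y = 0
    rw [pow_one] at hy
    have : a • (⊤ : Submodule R K) ≤ φ.hom.ker :=
      Submodule.smul_le.2 fun r hr x _ ↦ by
        rw [LinearMap.mem_ker, map_smul]
        exact hL r hr _
    exact this hy
  | succ n ih =>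
    obtain ⟨m, f, hf⟩ := Module.Finite.exists_fin' R K
    have hS := ModuleCat.shortExact_of_linearMap f.ker.subtype f f.ker.injective_subtype hf
      f.exact_subtype_ker
    have : Projective (ModuleCat.of R (Fin m → R)) := inferInstance
    obtain ⟨u, hu⟩ := Abelian.Ext.exists_forall_comp_eq_zero_of_shortExact (a := a) hS
      (ih (ModuleCat.of R f.ker)) e
    obtain ⟨k, hk⟩ := Ideal.exists_pow_inf_eq_pow_smul a f.ker
    have hmap : (a ^ (k + u) • ⊤ : Submodule R (Fin m → R)).map f = a ^ (k + u) • ⊤ := by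
      rw [Submodule.map_smul'', Submodule.map_top, LinearMap.range_eq_top.2 hf]
    let f' : (a ^ (k + u) • ⊤ : Submodule R (Fin m → R)) →ₗ[R]
        (a ^ (k + u) • ⊤ : Submodule R K) :=
      f.restrict fun x hx ↦ hmap ▸ Submodule.mem_map_of_mem hx
    have hf' : Function.Surjective f' := by
      rintro ⟨y, hy⟩
      rw [← hmap] at hy
      obtain ⟨x, hx, rfl⟩ := hy
      exact ⟨⟨x, hx⟩, rfl⟩
    have hT := ModuleCat.shortExact_of_linearMap (A := LinearMap.ker f')
      (B := (a ^ (k + u) • ⊤ : Submodule R (Fin m → R))) (C := (a ^ (k + u) • ⊤ : Submodule R K))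
      (LinearMap.ker f').subtype f'
      (Submodule.injective_subtype _) hf' f'.exact_subtype_ker
    have hker (x : f'.ker) : f x.1.1 = 0 := congrArg Subtype.val x.2
    refine ⟨k + u, hu _ hT
      { τ₁ := ModuleCat.ofHom ((((Submodule.subtype _).comp f'.ker.subtype)).codRestrict f.ker hker)
        τ₂ := ModuleCat.ofHom (Submodule.subtype _)
        τ₃ := ModuleCat.ofHom (Submodule.subtype _)
        comm₁₂ := rfl
        comm₂₃ := rfl } fun x ↦ ?_⟩
    refine Submodule.mem_smul_top_of_coe_mem ?_
    have h1 : x.1.1 ∈ a ^ (k + u) • ⊤ ⊓ f.ker := ⟨x.1.2, hker x⟩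
    rw [hk _ (by lia), Nat.add_sub_cancel_left] at h1
    exact Submodule.smul_mono le_rfl inf_le_right h1

lemma LocalCohomologyVanishes.succ_of_smul_eq_zero [IsNoetherianRing R] {L : ModuleCat.{u} R}
    (hL : ∀ x ∈ a, ∀ y : L, x • y = 0) (n : ℕ) : LocalCohomologyVanishes a (n + 1) L := by
  intro t e
  have hS (t : ℕ) := ModuleCat.shortExact_of_linearMap (a ^ t).subtype (a ^ t).mkQ
    (a ^ t).injective_subtype (a ^ t).mkQ_surjective
    (LinearMap.exact_subtype_mkQ _)
  have : Projective (ModuleCat.of R R) := inferInstance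
  obtain ⟨u, hu⟩ := Abelian.Ext.exists_forall_comp_eq_zero_of_shortExact (a := a) (hS t)
    (Abelian.Ext.exists_restrict_eq_zero_of_smul_eq_zero hL n (ModuleCat.of R ↥(a ^ t))) e
  refine ⟨t + u, by lia, hu _ (hS (t + u))
      { τ₁ := ModuleCat.ofHom (Submodule.inclusion (Ideal.pow_le_pow_right (by lia)))
        τ₂ := 𝟙 _
        τ₃ := quotientPowMap a (by lia)
        comm₁₂ := rfl
        comm₂₃ := rfl } fun x ↦ ?_⟩
  refine Submodule.mem_smul_top_of_coe_mem ?_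
  change x.1 ∈ a ^ u * a ^ t
  rw [← pow_add, add_comm]
  exact x.2

end

section

variable {R : Type u} [CommRing R]

/-- The multiplication map `R ⧸ (I : x) → R ⧸ I`. -/
def Ideal.quotientColonMap (I : Ideal R) (x : R) :
    (R ⧸ Submodule.comap (LinearMap.lsmul R R x) I) →ₗ[R] R ⧸ I :=
  Submodule.mapQ _ _ (LinearMap.lsmul R R x) le_rfl

/-- The projection `R ⧸ I → R ⧸ J` for `I ≤ J`, as an `R`-linear map. -/
def Ideal.quotientProj {I J : Ideal R} (h : I ≤ J) : (R ⧸ I) →ₗ[R] R ⧸ J :=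
  Submodule.mapQ _ _ LinearMap.id h

lemma Ideal.quotientProj_surjective {I J : Ideal R} (h : I ≤ J) :
    Function.Surjective (Ideal.quotientProj h) := by
  intro y
  obtain ⟨y, rfl⟩ := Submodule.Quotient.mk_surjective _ y
  exact ⟨Submodule.Quotient.mk y, rfl⟩

lemma Ideal.quotientColonMap_injective (I : Ideal R) (x : R) :
    Function.Injective (I.quotientColonMap x) := by
  rw [injective_iff_map_eq_zero]
  intro y hy
  obtain ⟨y, rfl⟩ := Submodule.Quotient.mk_surjective _ y
  exact (Submodule.Quotient.mk_eq_zero _).2 ((Submodule.Quotient.mk_eq_zero I).1 hy)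

lemma Ideal.quotientProj_sup_span_singleton_eq_zero_iff (I : Ideal R) (x : R) (y : R ⧸ I) :
    Ideal.quotientProj (le_sup_left (b := Ideal.span {x})) y = 0 ↔
      ∃ r : R, Submodule.Quotient.mk (x * r) = y := by
  obtain ⟨y, rfl⟩ := Submodule.Quotient.mk_surjective _ y
  refine (Submodule.Quotient.mk_eq_zero (I ⊔ Ideal.span {x})).trans ?_
  rw [Submodule.mem_sup]
  constructor
  · rintro ⟨i, hi, z, hz, rfl⟩
    obtain ⟨r, rfl⟩ := Ideal.mem_span_singleton.1 hz
    refine ⟨r, (Submodule.Quotient.eq I).2 ?_⟩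
    simpa using hi
  · rintro ⟨r, hr⟩
    exact ⟨y - x * r, (Submodule.Quotient.eq I).1 hr.symm, x * r,
      Ideal.mem_span_singleton.2 ⟨r, rfl⟩, sub_add_cancel _ _⟩

lemma Ideal.exact_quotientColonMap_quotientProj (I : Ideal R) (x : R) :
    Function.Exact (I.quotientColonMap x)
      (Ideal.quotientProj (le_sup_left (a := I) (b := Ideal.span {x}))) := by
  intro y
  rw [quotientProj_sup_span_singleton_eq_zero_iff]
  constructor
  · rintro ⟨r, rfl⟩
    exact ⟨Submodule.Quotient.mk r, rfl⟩
  · rintro ⟨r, rfl⟩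
    obtain ⟨r, rfl⟩ := Submodule.Quotient.mk_surjective _ r
    exact ⟨r, rfl⟩

lemma Ideal.exact_lsmul_quotientProj (I : Ideal R) (x : R) :
    Function.Exact (LinearMap.lsmul R (R ⧸ I) x)
      (Ideal.quotientProj (le_sup_left (a := I) (b := Ideal.span {x}))) := by
  intro y
  rw [quotientProj_sup_span_singleton_eq_zero_iff]
  constructor
  · rintro ⟨r, rfl⟩
    exact ⟨Submodule.Quotient.mk r, rfl⟩
  · rintro ⟨r, rfl⟩
    obtain ⟨r, rfl⟩ := Submodule.Quotient.mk_surjective _ r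
    exact ⟨r, rfl⟩

lemma Ideal.induction_colon_sup_prime [IsNoetherianRing R] {P : Ideal R → Prop} (top : P ⊤)
    (step : ∀ (I : Ideal R) (x : R), P (Submodule.comap (LinearMap.lsmul R R x) I) →
      P (I ⊔ Ideal.span {x}) → P I)
    (prime : ∀ p : Ideal R, p.IsPrime → (∀ I, p < I → P I) → P p) (I : Ideal R) : P I := by
  induction I using WellFoundedGT.induction with
  | ind I ih =>
    by_cases hI : I.IsPrime
    · exact prime I hI ih
    rcases (Ideal.not_isPrime_iff.1 hI) with rfl | ⟨x, hx, y, hy, hxy⟩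
    · exact top
    · refine step I x (ih _ ?_) (ih _ ?_)
      · exact lt_of_le_of_ne (fun z hz ↦ I.mul_mem_left x hz)
          fun h ↦ hy (h ▸ (show y ∈ Submodule.comap (LinearMap.lsmul R R x) I from hxy))
      · exact lt_of_le_of_ne le_sup_left fun h ↦ hx (h ▸ Ideal.mem_sup_right
          (Ideal.mem_span_singleton_self x))

lemma ringKrullDim_quotient_le_of_le {I J : Ideal R} (h : I ≤ J) :
    ringKrullDim (R ⧸ J) ≤ ringKrullDim (R ⧸ I) :=
  ringKrullDim_le_of_surjective (Ideal.Quotient.factor h) (Ideal.Quotient.factor_surjective h)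

lemma ringKrullDim_quotient_sup_span_singleton_succ_le {p : Ideal R} [p.IsPrime] {x : R}
    (hx : x ∉ p) : ringKrullDim (R ⧸ p ⊔ Ideal.span {x}) + 1 ≤ ringKrullDim (R ⧸ p) := by
  have h : Ideal.Quotient.mk p x ∈ nonZeroDivisors (R ⧸ p) :=
    mem_nonZeroDivisors_of_ne_zero fun h ↦ hx (Ideal.Quotient.eq_zero_iff_mem.1 h)
  refine le_trans ?_ (ringKrullDim_quotient_succ_le_of_nonZeroDivisor h)
  gcongr
  rw [← Set.image_singleton, ← Ideal.map_span]
  exact (ringKrullDim_eq_of_ringEquiv (DoubleQuot.quotQuotEquivQuotSup p (Ideal.span {x}))).ge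

namespace LocalCohomologyVanishes

variable [IsNoetherianRing R] {a : Ideal R}

/-- Grothendieck vanishing for cyclic modules. -/
lemma quotient_of_ringKrullDim_lt (n : ℕ) (I : Ideal R) (hI : ringKrullDim (R ⧸ I) < n)
    {j : ℕ} (hj : n ≤ j) : LocalCohomologyVanishes a j (ModuleCat.of R (R ⧸ I)) := by
  induction n generalizing I j with
  | zero =>
    have : Subsingleton (R ⧸ I) := by
      rw [← not_nontrivial_iff_subsingleton]
      intro h
      exact absurd hI (not_lt.2 ringKrullDim_nonneg_of_nontrivial)
    exact of_subsingleton _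
  | succ n ih =>
    induction I using Ideal.induction_colon_sup_prime with
    | top =>
      have : Subsingleton (R ⧸ (⊤ : Ideal R)) := Ideal.Quotient.subsingleton_iff.2 rfl
      exact of_subsingleton _
    | step I x h₁ h₂ =>
      exact of_exact₂ (I.quotientColonMap_injective x) (Ideal.quotientProj_surjective _)
        (I.exact_quotientColonMap_quotientProj x)
        (h₁ ((ringKrullDim_quotient_le_of_le fun z hz ↦ I.mul_mem_left x hz).trans_lt hI))
        (h₂ ((ringKrullDim_quotient_le_of_le le_sup_left).trans_lt hI))
    | prime p hp _ =>
      obtain ⟨j, rfl⟩ : ∃ i, j = i + 1 := ⟨j - 1, by lia⟩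
      by_cases hap : a ≤ p
      · refine succ_of_smul_eq_zero (fun x hx y ↦ ?_) j
        obtain ⟨y, rfl⟩ := Submodule.Quotient.mk_surjective _ y
        exact (Submodule.Quotient.mk_eq_zero p).2 (p.mul_mem_right _ (hap hx))
      · obtain ⟨x, hxa, hxp⟩ := Set.not_subset.1 hap
        refine of_isSMulRegular hxa ?_ (Ideal.quotientProj_surjective _)
          (p.exact_lsmul_quotientProj x) (ih _ ?_ (by lia))
        · rw [isSMulRegular_iff_right_eq_zero_of_smul]
          intro y hy
          obtain ⟨y, rfl⟩ := Submodule.Quotient.mk_surjective _ y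
          exact (Submodule.Quotient.mk_eq_zero p).2
            ((hp.mem_or_mem ((Submodule.Quotient.mk_eq_zero p).1 hy)).resolve_left hxp)
        · have := (ringKrullDim_quotient_sup_span_singleton_succ_le hxp).trans_lt hI
          generalize ringKrullDim (R ⧸ p ⊔ Ideal.span {x}) = d at this ⊢
          induction d with
          | bot => exact WithBot.bot_lt_coe _
          | coe d =>
            norm_cast at this ⊢
            exact lt_of_add_lt_add_right this

lemma of_forall_prime {j : ℕ}
    (h : ∀ p : Ideal R, p.IsPrime → LocalCohomologyVanishes a j (ModuleCat.of R (R ⧸ p)))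
    (M : Type u) [AddCommGroup M] [Module R M] [Module.Finite R M] :
    LocalCohomologyVanishes a j (ModuleCat.of R M) := by
  induction ‹Module.Finite R M› using
    IsNoetherianRing.induction_on_isQuotientEquivQuotientPrime R with
  | subsingleton N => exact of_subsingleton _
  | quotient N p f => exact of_linearEquiv f.symm (h p.1 p.2)
  | exact N₁ N₂ N₃ f g hf hg hfg h₁ h₃ => exact of_exact₂ hf hg hfg h₁ h₃

lemma of_forall_exists_linearMap_ne_zero {N : Type u} [AddCommGroup N] [Module R N]
    [Module.Finite R N] (hN : ∀ p : Ideal R, p.IsPrime → ∃ f : N →ₗ[R] R ⧸ p, f ≠ 0) {j : ℕ}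
    (hj : LocalCohomologyVanishes a j (ModuleCat.of R N))
    (h : ∀ (M : Type u) [AddCommGroup M] [Module R M] [Module.Finite R M],
      LocalCohomologyVanishes a (j + 1) (ModuleCat.of R M))
    (M : Type u) [AddCommGroup M] [Module R M] [Module.Finite R M] :
    LocalCohomologyVanishes a j (ModuleCat.of R M) := by
  suffices H : ∀ I : Ideal R, LocalCohomologyVanishes a j (ModuleCat.of R (R ⧸ I)) from
    of_forall_prime (fun p _ ↦ H p) M
  intro I
  induction I using Ideal.induction_colon_sup_prime with
  | top =>
    have : Subsingleton (R ⧸ (⊤ : Ideal R)) := Ideal.Quotient.subsingleton_iff.2 rfl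
    exact of_subsingleton _
  | step I x h₁ h₂ =>
    exact of_exact₂ (I.quotientColonMap_injective x) (Ideal.quotientProj_surjective _)
      (I.exact_quotientColonMap_quotientProj x) h₁ h₂
  | prime p hp ih =>
    obtain ⟨f, hf⟩ := hN p hp
    have hrange : LocalCohomologyVanishes a j (ModuleCat.of R f.range) :=
      of_exact₃ f.ker.injective_subtype f.surjective_rangeRestrict
        (by rw [LinearMap.exact_iff, LinearMap.ker_rangeRestrict, Submodule.range_subtype])
        (h f.ker) hj
    let I : Ideal R := f.range.comap p.mkQ
    have hpI : p ≤ I := fun x hx ↦ by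
      change p.mkQ x ∈ f.range
      rw [Submodule.mkQ_apply, (Submodule.Quotient.mk_eq_zero p).2 hx]
      exact zero_mem _
    refine of_exact₂ f.range.injective_subtype (Ideal.quotientProj_surjective hpI) ?_ hrange
      (ih I (lt_of_le_of_ne hpI fun h ↦ hf ?_))
    · intro y
      obtain ⟨y, rfl⟩ := Submodule.Quotient.mk_surjective _ y
      refine (Submodule.Quotient.mk_eq_zero I).trans ?_
      rw [Submodule.coe_subtype, Subtype.range_coe]
      rfl
    · ext x
      obtain ⟨y, hy⟩ := Submodule.Quotient.mk_surjective _ (f x)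
      rw [LinearMap.zero_apply, ← hy]
      exact (Submodule.Quotient.mk_eq_zero p).2 (h ▸ (show y ∈ I from ⟨x, hy.symm⟩))

/-- If `H^j_a(N) = 0` for all `j ≥ c`, where `N` is finitely generated and maps nontrivially to
each `R ⧸ p`, then `H^j_a(M) = 0` for all `j ≥ c` and all finitely generated `M`. -/
lemma of_forall_le {N : Type u} [AddCommGroup N] [Module R N]
    [Module.Finite R N] (hR : ringKrullDim R ≠ ⊤)
    (hN : ∀ p : Ideal R, p.IsPrime → ∃ f : N →ₗ[R] R ⧸ p, f ≠ 0) {c : ℕ}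
    (hc : ∀ j ≥ c, LocalCohomologyVanishes a j (ModuleCat.of R N)) {j : ℕ} (hj : c ≤ j)
    (M : Type u) [AddCommGroup M] [Module R M] [Module.Finite R M] :
    LocalCohomologyVanishes a j (ModuleCat.of R M) := by
  obtain ⟨d, hd⟩ : ∃ d : ℕ, ringKrullDim R < d := by
    generalize ringKrullDim R = d at hR
    induction d with
    | bot => exact ⟨0, WithBot.bot_lt_coe _⟩
    | coe d =>
      lift d to ℕ using fun h ↦ hR (h ▸ rfl)
      exact ⟨d + 1, by norm_cast; exact Nat.lt_succ_self _⟩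
  obtain ⟨k, hk⟩ : ∃ k, d ≤ j + k := ⟨d, by lia⟩
  induction k generalizing j M with
  | zero =>
    exact of_forall_prime (fun p _ ↦ quotient_of_ringKrullDim_lt d p
      ((ringKrullDim_quotient_le p).trans_lt hd) hk) M
  | succ k ih =>
    exact of_forall_exists_linearMap_ne_zero hN (hc j hj)
      (fun M _ _ _ ↦ ih (by lia) M (by lia)) M

end LocalCohomologyVanishes
end

section
variable {R : Type u} [CommRing R]

lemma Module.exists_linearMap_quotient_ne_zero {N : Type*} [AddCommGroup N] [Module R N]
    [Module.Finite R N] (p : Ideal R) [p.IsPrime] (hp : ⟨p, ‹_›⟩ ∈ Module.support R N) :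
    ∃ f : N →ₗ[R] R ⧸ p, f ≠ 0 := by
  have := (Module.mem_support_iff_nontrivial_residueField_tensorProduct _).1 hp
  change Nontrivial (p.ResidueField ⊗[R] N) at this
  obtain ⟨x, hx⟩ := exists_ne (0 : p.ResidueField ⊗[R] N)
  obtain ⟨φ, hφ⟩ : ∃ φ : Module.Dual p.ResidueField (p.ResidueField ⊗[R] N), φ x ≠ 0 := by
    by_contra! h
    exact hx ((Module.forall_dual_apply_eq_zero_iff _ _).1 h)
  let ψ : N →ₗ[R] p.ResidueField := (φ.restrictScalars R).comp (TensorProduct.mk R _ N 1)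
  obtain ⟨y, hy⟩ : ∃ y, ψ y ≠ 0 := by
    by_contra! h
    refine hφ ?_
    clear hx hφ
    induction x with
    | zero => simp
    | add x y hx hy => rw [map_add, hx, hy, add_zero]
    | tmul c y =>
      rw [← mul_one c, ← smul_eq_mul, ← TensorProduct.smul_tmul', map_smul,
        show φ (1 ⊗ₜ y) = 0 from h y, smul_zero]
  obtain ⟨S, hS⟩ := Module.Finite.fg_top (R := R) (M := N)
  obtain ⟨⟨b, hb0⟩, hb⟩ :=
    IsLocalization.exist_integer_multiples (nonZeroDivisors (R ⧸ p)) S ψ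
  obtain ⟨b, rfl⟩ := Ideal.Quotient.mk_surjective b
  let ι : (R ⧸ p) →ₗ[R] p.ResidueField := (IsScalarTower.toAlgHom R (R ⧸ p) _).toLinearMap
  have hι : Function.Injective ι := IsFractionRing.injective (R ⧸ p) p.ResidueField
  let ψ' : N →ₗ[R] p.ResidueField := b • ψ
  have hψb (z : N) : Ideal.Quotient.mk p b • ψ z = ψ' z := algebraMap_smul (R ⧸ p) b (ψ z)
  have hψ' : ∀ z, ψ' z ∈ LinearMap.range ι := by
    have : Submodule.span R (S : Set N) ≤ (LinearMap.range ι).comap ψ' := by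
      rw [Submodule.span_le]
      intro z hz
      obtain ⟨c, hc⟩ := hb z hz
      exact ⟨c, hc.trans (hψb z)⟩
    exact fun z ↦ this (hS ▸ Submodule.mem_top)
  refine ⟨(LinearEquiv.ofInjective ι hι).symm.toLinearMap.comp (ψ'.codRestrict _ hψ'),
    fun h ↦ ?_⟩
  have h : (LinearEquiv.ofInjective ι hι).symm ⟨ψ' y, hψ' y⟩ = 0 := LinearMap.congr_fun h y
  rw [LinearEquiv.map_eq_zero_iff, Subtype.ext_iff] at h
  have h := (hψb y).trans h
  rw [Algebra.smul_def] at h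
  exact nonZeroDivisors.ne_zero hb0 (hι (((mul_eq_zero.1 h).resolve_right hy).trans
    (map_zero ι).symm))

lemma Module.support_linearMap_self_of_support_eq_univ [IsNoetherianRing R] {M : Type*}
    [AddCommGroup M] [Module R M] [Module.Finite R M] (hM : Module.support R M = Set.univ) :
    Module.support R (M →ₗ[R] R) = Set.univ := by
  refine Set.eq_univ_of_forall fun p ↦ ?_
  obtain ⟨q, hq, hqp⟩ := Ideal.exists_minimalPrimes_le (I := Module.annihilator R R) (J := p.1)
    (by rw [Module.annihilator_eq_bot.2 inferInstance]; exact bot_le)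
  have hq' := Module.associatedPrimes.minimalPrimes_annihilator_subset_associatedPrimes R R hq
  rw [AssociatedPrimes.mem_iff, isAssociatedPrime_iff] at hq'
  obtain ⟨hqprime, x, hx⟩ := hq'
  refine Module.mem_support_mono (p := ⟨q, hqprime⟩) hqp ?_
  rw [Module.mem_support_iff']
  obtain ⟨f, hf⟩ := Module.exists_linearMap_quotient_ne_zero q
    (hM.symm ▸ Set.mem_univ _ : (⟨q, hqprime⟩ : PrimeSpectrum R) ∈ Module.support R M)
  obtain ⟨m, hm⟩ : ∃ m, f m ≠ 0 := by
    by_contra! h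
    exact hf (LinearMap.ext h)
  have hxq (r : R) : r * x = 0 ↔ r ∈ q := by
    rw [hx, Submodule.mem_colon_singleton, Submodule.mem_bot, smul_eq_mul]
  refine ⟨(Submodule.liftQ q (LinearMap.toSpanSingleton R R x) fun r hr ↦
    (hxq r).2 hr).comp f, fun r hr h ↦ ?_⟩
  obtain ⟨y, hy⟩ := Submodule.Quotient.mk_surjective _ (f m)
  have h : r * (y * x) = 0 := by
    have h := LinearMap.congr_fun h m
    rwa [LinearMap.smul_apply, LinearMap.comp_apply, ← hy] at h
  rw [← hy] at hm
  rw [← mul_assoc, hxq] at h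
  exact hm ((Submodule.Quotient.mk_eq_zero q).2 ((hqprime.mem_or_mem h).resolve_left hr))

/-- `Ext^0(M, N)` is the module of linear maps from `M` to `N`. -/
noncomputable def ModuleCat.extZeroLinearEquiv (M N : ModuleCat.{u} R) :
    ((Ext R (ModuleCat.{u} R) 0).obj (Opposite.op M)).obj N ≃ₗ[R] (M →ₗ[R] N) :=
  haveI : PreservesLimits ((linearYoneda R (ModuleCat.{u} R)).obj N ⋙ forget _) :=
    inferInstanceAs (PreservesLimits (yoneda.obj N))
  haveI : PreservesLimits ((linearYoneda R (ModuleCat.{u} R)).obj N) :=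
    preservesLimits_of_reflects_of_preserves _ (forget _)
  haveI := preservesFiniteColimits_rightOp ((linearYoneda R (ModuleCat.{u} R)).obj N)
  (((linearYoneda R (ModuleCat.{u} R)).obj N).rightOp.leftDerivedZeroIsoSelf.app
    M).unop.symm.toLinearEquiv.trans (ModuleCat.homLinearEquiv (S := R))

end

end LocalCohomology

/-- Corollary 3.4, second part: over a commutative Noetherian ring `R` of finite
Krull dimension, if `M` is finitely generated of finite projective dimension with
`Supp_R M = Spec R`, then `cd(a, R) ≤ sup_i (cd(a, Ext^i_R(M, R)) + i)`. -/
theorem cohDim_self_le_iSup_cohDim_ext_add (R : Type u) [CommRing R] [IsNoetherianRing R]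
    (hfin : ringKrullDim R ≠ ⊤) (a : Ideal R)
    (M : ModuleCat.{u} R) [Module.Finite R M]
    (hpd : ∃ n : ℕ, projDimLE R M n)
    (hsupp : Module.support R M = Set.univ) :
    cohDim R a (ModuleCat.of R R)
      ≤ ⨆ i : ℕ, (cohDim R a (extMod R i M (ModuleCat.of R R)) + (i : WithBot ℕ∞)) := by
  refine iSup₂_le fun i hi ↦ ?_
  let N := extMod R 0 M (ModuleCat.of R R)
  let e : N ≃ₗ[R] (M →ₗ[R] R) := ModuleCat.extZeroLinearEquiv M (ModuleCat.of R R)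
  have hfg : IsNoetherian R (M →ₗ[R] R) := isNoetherian_linearMap R R M
  have : Module.Finite R N := (Module.IsNoetherian.finite R (M →ₗ[R] R)).equiv e.symm
  have hN : Module.support R N = Set.univ :=
    e.support_eq.trans (Module.support_linearMap_self_of_support_eq_univ hsupp)
  obtain ⟨j, hj, hjN⟩ : ∃ j ≥ i, ¬ Subsingleton ((localCohomology a j).obj N) := by
    by_contra! h
    refine hi ((subsingleton_localCohomology_iff a i _).2 ?_)
    exact LocalCohomologyVanishes.of_forall_le (N := N) hfin
      (fun p _ ↦ Module.exists_linearMap_quotient_ne_zero p (hN ▸ Set.mem_univ _))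
      (fun j hj ↦ (subsingleton_localCohomology_iff a j N).1 (h j hj)) le_rfl R
  calc (i : WithBot ℕ∞) ≤ (j : WithBot ℕ∞) := by exact_mod_cast hj
    _ ≤ cohDim R a N := le_iSup₂_of_le j hjN le_rfl
    _ = cohDim R a N + ((0 : ℕ) : WithBot ℕ∞) := by simp
    _ ≤ _ := le_iSup (fun i : ℕ ↦ cohDim R a (extMod R i M (ModuleCat.of R R)) +
      (i : WithBot ℕ∞)) 0
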